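/- Let G = (ℤ/p)^k be an elementary abelian p-group and let M be an F_p[G]-module admitting a finite filtration whose successive quotients are finite direct sums of modules induced from proper subgroups of G. If ξ ∈ H*(G; F_p) restricts to zero in H*(H; F_p) for every proper subgroup H < G, then multiplication by ξ on the group cohomology H*(G; M) is nilpotent. -/

import Mathlib

/-!  **Statement 5.**  Setup as in the paper: `G = (ℤ/p)^k` is elementary abelian, and `M` is
an `F_p[G]`-module lying in the family `𝔉𝔍_G` (finite filtration with successive quotients
finite direct sums of modules induced from proper subgroups; since `G` is finite, induced and
coinduced modules agree, and we realize the module induced from a representation `τ` of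
`H ≤ G` as the coinduced module).  Group cohomology is realized by the standard complex of
inhomogeneous cochains, and multiplication by a class `ξ ∈ H^*(G; F_p)` is realized by the
cup product on cochains; nilpotency of the multiplication by `ξ` means that for some `D`,
every product `ξ^D ∪ φ` with a cocycle `φ` is a coboundary. -/

section Cochains

variable {k : Type} [CommRing k] {K : Type} [Group K]
variable {V : Type} [AddCommGroup V] [Module k V]

/-- The differential on inhomogeneous group cochains with coefficients in `ρ`. -/
def dRep (ρ : Representation k K V) (n : ℕ) (φ : (Fin n → K) → V) :
    (Fin (n + 1) → K) → V :=
  fun g =>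
    ρ (g 0) (φ fun i => g i.succ) +
      ∑ j : Fin (n + 1), ((-1 : ℤ) ^ ((j : ℕ) + 1)) • φ (Fin.contractNth j (· * ·) g)

/-- An inhomogeneous `n`-cochain is a coboundary (in degree `0`: is zero). -/
def IsCoboundRep (ρ : Representation k K V) : (n : ℕ) → ((Fin n → K) → V) → Prop
  | 0, φ => φ = 0
  | (m + 1), φ => ∃ ψ : (Fin m → K) → V, φ = dRep ρ m ψ

/-- The cup product of a cochain with trivial `k`-coefficients and a cochain with
coefficients in `ρ`. -/
def cupRep (ρ : Representation k K V) (a b : ℕ) (θ : (Fin a → K) → k)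
    (ψ : (Fin b → K) → V) : (Fin (a + b) → K) → V :=
  fun g =>
    θ (fun i => g (Fin.castAdd b i)) •
      ρ ((List.ofFn fun i : Fin a => g (Fin.castAdd b i)).prod)
        (ψ fun i => g (Fin.natAdd a i))

/-- The `D`-fold cup power `ξ^{∪D}` of a cochain `ξ` with trivial `k`-coefficients. -/
def cupPow (e : ℕ) (ξ : (Fin e → K) → k) : (D : ℕ) → ((Fin (D * e) → K) → k)
  | 0 => fun _ => 1
  | (D + 1) => fun g =>
      ξ (fun i => g (Fin.cast (by ring) (Fin.castAdd (D * e) i))) *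
        cupPow e ξ D (fun i => g (Fin.cast (by ring) (Fin.natAdd e i)))

end Cochains

section Coind

variable (k : Type) [CommRing k] {G : Type} [Group G] (H : Subgroup G)
variable {V : Type} [AddCommGroup V] [Module k V]

/-- The underlying `k`-module of the (co)induced module `Ind_H^G V` of a representation
`τ : H →* GL(V)`. -/
def coindV (τ : Representation k H V) : Submodule k (G → V) where
  carrier := {f | ∀ (h : H) (g : G), f ((h : G) * g) = τ h (f g)}
  add_mem' := by
    intro a b ha hb h g
    simp [ha h g, hb h g]
  zero_mem' := by
    intro h g
    simp
  smul_mem' := by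
    intro c f hf h g
    simp [hf h g]

/-- The representation of `G` on the (co)induced module, by right translation. -/
def coindRep (τ : Representation k H V) : Representation k G (coindV k H τ) where
  toFun g :=
    { toFun := fun f => ⟨fun x => (f : G → V) (x * g), by
        intro h x
        show (f : G → V) (↑h * x * g) = τ h ((f : G → V) (x * g))
        rw [mul_assoc]
        exact f.2 h (x * g)⟩
      map_add' := by
        intro f₁ f₂
        ext x
        rfl
      map_smul' := by
        intro c f
        ext x
        rfl }
  map_one' := by
    apply LinearMap.ext
    intro f
    apply Subtype.ext
    funext x
    simp [mul_one]
  map_mul' := by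
    intro g₁ g₂
    apply LinearMap.ext
    intro f
    apply Subtype.ext
    funext x
    simp [mul_assoc]

end Coind

/-- A representation of a proper subgroup `H < G` over `F_p`, the inducing datum for a
module induced from a proper subgroup. -/
structure ProperInducedRep (p : ℕ) (G : Type) [Group G] where
  H : Subgroup G
  proper : H ≠ ⊤
  V : Type
  [instAdd : AddCommGroup V]
  [instMod : Module (ZMod p) V]
  rep : Representation (ZMod p) H V

attribute [instance] ProperInducedRep.instAdd ProperInducedRep.instMod

/-- The `F_p[G]`-module induced from the datum `P` (induced = coinduced, `G` finite). -/
noncomputable abbrev ProperInducedRep.asMod {p : ℕ} {G : Type} [Group G]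
    (P : ProperInducedRep p G) : Type :=
  (coindRep (ZMod p) P.H P.rep).asModule

/-- The family `𝔍_G`: `F_p[G]`-modules isomorphic to a finite direct sum of modules induced
from proper subgroups of `G` (the empty sum, i.e. the zero module, is allowed). -/
def InJ (p : ℕ) (G : Type) [Group G] (M : Type) [AddCommGroup M]
    [Module (MonoidAlgebra (ZMod p) G) M] : Prop :=
  ∃ (t : ℕ) (P : Fin t → ProperInducedRep p G),
    Nonempty (M ≃ₗ[MonoidAlgebra (ZMod p) G] DirectSum (Fin t) fun i => (P i).asMod)

/-- The family `𝔉𝔍_G`: `F_p[G]`-modules admitting a finite filtration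
`0 = M₀ ⊆ M₁ ⊆ ⋯ ⊆ M_r = M` whose successive quotients belong to `𝔍_G`. -/
def InFJ (p : ℕ) (G : Type) [Group G] (M : Type) [AddCommGroup M]
    [Module (MonoidAlgebra (ZMod p) G) M] : Prop :=
  ∃ (r : ℕ) (F : Fin (r + 1) → Submodule (MonoidAlgebra (ZMod p) G) M),
    Monotone F ∧ F 0 = ⊥ ∧ F (Fin.last r) = ⊤ ∧
    ∀ i : Fin r,
      InJ p G (F i.succ ⧸ Submodule.comap (F i.succ).subtype (F i.castSucc))


namespace LC

section Homog

variable {X : Type} {V : Type} [AddCommGroup V]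

/-- Homogeneous differential on cochains defined on lists (all degrees at once). -/
def hd : (List X → V) → List X → V
  | _, [] => 0
  | F, x :: l => F l - hd (fun m => F (x :: m)) l

theorem hd_nil (F : List X → V) : hd F [] = 0 := rfl

theorem hd_cons (F : List X → V) (x : X) (l : List X) :
    hd F (x :: l) = F l - hd (fun m => F (x :: m)) l := rfl

theorem hd_zero (l : List X) : hd (fun _ => (0 : V)) l = 0 := by
  induction l with
  | nil => rfl
  | cons x l ih => rw [hd_cons, ih, sub_zero]

theorem hd_add (F E : List X → V) (l : List X) :
    hd (fun m => F m + E m) l = hd F l + hd E l := by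
  induction l generalizing F E with
  | nil => simp [hd_nil]
  | cons x l ih => rw [hd_cons, hd_cons, hd_cons, ih]; abel

theorem hd_sub (F E : List X → V) (l : List X) :
    hd (fun m => F m - E m) l = hd F l - hd E l := by
  induction l generalizing F E with
  | nil => simp [hd_nil]
  | cons x l ih => rw [hd_cons, hd_cons, hd_cons, ih]; abel

theorem hd_hd (F : List X → V) (l : List X) : hd (hd F) l = 0 := by
  induction l generalizing F with
  | nil => rfl
  | cons x l ih =>
    rw [hd_cons]
    simp only [hd_cons]
    rw [hd_sub, ih]; abel

theorem hd_map {Y : Type} (s : X → Y) (F : List Y → V) (l : List X) :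
    hd (fun m => F (m.map s)) l = hd F (l.map s) := by
  induction l generalizing F with
  | nil => rfl
  | cons x l ih =>
    rw [hd_cons, List.map_cons, hd_cons, ← ih]
    rfl

/-- Prism operator. -/
def pr (s : X → X) : (List X → V) → List X → V
  | _, [] => 0
  | F, x :: l => F (x :: s x :: l.map s) - pr s (fun m => F (x :: m)) l

theorem pr_cons (s : X → X) (F : List X → V) (x : X) (l : List X) :
    pr s F (x :: l) = F (x :: s x :: l.map s) - pr s (fun m => F (x :: m)) l := rfl

theorem pr_zero (s : X → X) (l : List X) : pr s (fun _ => (0 : V)) l = 0 := by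
  induction l with
  | nil => rfl
  | cons x l ih => rw [pr_cons, ih, sub_zero]

theorem pr_sub (s : X → X) (F E : List X → V) (l : List X) :
    pr s (fun m => F m - E m) l = pr s F l - pr s E l := by
  induction l generalizing F E with
  | nil => simp [pr]
  | cons x l ih => rw [pr_cons, pr_cons, pr_cons, ih]; abel

theorem prism (s : X → X) (F : List X → V) (l : List X) :
    hd (pr s F) l + pr s (hd F) l = F (l.map s) - F l := by
  induction l generalizing F with
  | nil => simp [hd, pr]
  | cons x l ih =>
    have h := ih (fun m => F (x :: m))
    rw [hd_cons, pr_cons]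
    simp only [pr_cons, hd_cons]
    rw [hd_sub, pr_sub, hd_map s (fun m => F (x :: s x :: m)) l, List.map_cons]
    have h' : hd (pr s fun m => F (x :: m)) l =
      F (x :: l.map s) - F (x :: l) - pr s (hd fun m => F (x :: m)) l := by
      rw [← h]; abel
    rw [h']
    abel

theorem pr_equiv (s h : X → X) (hs : ∀ x, s (h x) = h (s x)) (F : List X → V) (l : List X) :
    pr s F (l.map h) = pr s (fun m => F (m.map h)) l := by
  induction l generalizing F with
  | nil => rfl
  | cons x l ih =>
    rw [List.map_cons, pr_cons, pr_cons, ih]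
    simp [hs, Function.comp_def]

variable {k : Type} [CommRing k] [Module k V]

/-- Homogeneous cup product. -/
def hcup : ℕ → (List X → k) → (List X → V) → List X → V
  | _, _, _, [] => 0
  | 0, F, E, x :: l => F [x] • E (x :: l)
  | a + 1, F, E, x :: l => hcup a (fun m => F (x :: m)) E l

theorem hcup_nil (a : ℕ) (F : List X → k) (E : List X → V) : hcup a F E [] = 0 := by
  cases a <;> rfl

theorem hcup_sub (a : ℕ) (F F' : List X → k) (E : List X → V) (l : List X) :
    hcup a (fun m => F m - F' m) E l = hcup a F E l - hcup a F' E l := by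
  induction a generalizing F F' l with
  | zero => cases l <;> simp [hcup, sub_smul]
  | succ a ih => cases l with
    | nil => simp [hcup]
    | cons x l => simp only [hcup]; rw [ih]

theorem hcup_zero_right (a : ℕ) (F : List X → k) (l : List X) :
    hcup a F (fun _ => (0 : V)) l = 0 := by
  induction a generalizing F l with
  | zero => cases l <;> simp [hcup]
  | succ a ih => cases l with
    | nil => simp [hcup]
    | cons x l => simp only [hcup]; rw [ih]

theorem hcup_zero_left (a : ℕ) (E : List X → V) (l : List X) :
    hcup a (fun _ => (0 : k)) E l = 0 := by
  induction a generalizing l with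
  | zero => cases l <;> simp [hcup]
  | succ a ih => cases l with
    | nil => simp [hcup]
    | cons x l => simp only [hcup]; rw [ih]

theorem hd_smul (c : k) (F : List X → V) (l : List X) :
    hd (fun m => c • F m) l = c • hd F l := by
  induction l generalizing F with
  | nil => simp [hd_nil]
  | cons x l ih => rw [hd_cons, hd_cons, ih, smul_sub]

theorem leibniz (a : ℕ) (F : List X → k) (E : List X → V) (hE : E [] = 0) (l : List X) :
    hd (hcup a F E) l = hcup (a + 1) (hd F) E l + (-1 : ℤ) ^ a • hcup a F (hd E) l := by
  induction a generalizing F l with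
  | zero =>
    cases l with
    | nil => simp [hd, hcup]
    | cons x l =>
      cases l with
      | nil => simp [hd, hcup, hE]
      | cons y l =>
        rw [hd_cons]
        have : (fun m => hcup 0 F E (x :: m)) = fun m => F [x] • E (x :: m) := rfl
        rw [this, hd_smul]
        simp [hcup, hd_cons, hd_nil, sub_smul, smul_sub]
  | succ a ih =>
    cases l with
    | nil => simp [hd, hcup]
    | cons x l =>
      rw [hd_cons]
      have : (fun m => hcup (a+1) F E (x :: m)) = hcup a (fun m => F (x :: m)) E := rfl
      rw [this, ih]
      have h2 : hcup (a + 1 + 1) (hd F) E (x :: l) =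
        hcup (a+1) (fun m => F m - hd (fun m' => F (x :: m')) m) E l := rfl
      rw [h2, hcup_sub]
      have h3 : hcup (a + 1) F (hd E) (x :: l) = hcup a (fun m => F (x :: m)) (hd E) l := rfl
      rw [h3, pow_succ]
      simp
      abel

theorem hcup_equiv (h : X → X) (T : V →ₗ[k] V) (a : ℕ) (F : List X → k) (E : List X → V)
    (hF : ∀ l, F (l.map h) = F l)
    (hE : ∀ l, E (l.map h) = T (E l)) (l : List X) :
    hcup a F E (l.map h) = T (hcup a F E l) := by
  have gen : ∀ (a : ℕ) (F F' : List X → k) (l : List X), (∀ l, F (l.map h) = F' l) →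
      hcup a F E (l.map h) = T (hcup a F' E l) := by
    intro a
    induction a with
    | zero =>
      intro F F' l hF
      cases l with
      | nil => simp [hcup]
      | cons x l =>
        have h1 := hF [x]
        have h2 := hE (x :: l)
        simp only [List.map_cons, List.map_nil] at h1 h2
        simp [hcup, h1, h2]
    | succ a ih =>
      intro F F' l hF
      cases l with
      | nil => simp [hcup]
      | cons x l =>
        simp only [List.map_cons, hcup]
        exact ih _ _ _ (fun m => by simpa using hF (x :: m))
  exact gen a F F l hF

end Homog

section Inhom

variable {G : Type} [Group G] {N V : Type} [AddCommGroup N] [AddCommGroup V]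

/-- The part of the bar differential not involving the action. -/
def bp : (List G → N) → List G → N
  | _, [] => 0
  | φ, [_] => - φ []
  | φ, x :: y :: l => - φ (x * y :: l) - bp (fun m => φ (x :: m)) (y :: l)

/-- Inhomogeneous differential on list cochains. -/
def dl (act : G → N → N) (φ : List G → N) : List G → N
  | [] => 0
  | x :: l => act x (φ l) + bp φ (x :: l)

def path : G → List G → List G
  | _, [] => []
  | g, x :: l => g * x :: path (g * x) l

def diffs : G → List G → List G
  | _, [] => []
  | g, x :: l => g⁻¹ * x :: diffs x l

theorem diffs_path (g : G) (l : List G) : diffs g (path g l) = l := by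
  induction l generalizing g with
  | nil => rfl
  | cons x l ih => simp [path, diffs, ih]

theorem path_diffs (g : G) (l : List G) : path g (diffs g l) = l := by
  induction l generalizing g with
  | nil => rfl
  | cons x l ih => simp [path, diffs, ih]

theorem diffs_map (h g : G) (l : List G) : diffs (h * g) (l.map (h * ·)) = diffs g l := by
  induction l generalizing g with
  | nil => rfl
  | cons x l ih => simp [diffs, ih, mul_assoc]

theorem path_map (h g : G) (l : List G) : path (h * g) l = (path g l).map (h * ·) := by
  induction l generalizing g with
  | nil => rfl
  | cons x l ih => simp [path, mul_assoc, ih]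

theorem diffs_hom {K : Type} [Group K] (f : K →* G) (g : K) (l : List K) :
    diffs (f g) (l.map f) = (diffs g l).map f := by
  induction l generalizing g with
  | nil => rfl
  | cons x l ih => simp [diffs, ih]

theorem hd_path (T : N →+ V) (g x : G) (l : List G) (φ : List G → N) (F : List G → V)
    (h : ∀ l, F (path g l) = T (φ l)) :
    hd F (path g (x :: l)) = - T (bp φ (x :: l)) := by
  induction l generalizing g x φ F with
  | nil =>
    have := h []
    simp only [path] at this
    simp [path, hd, bp, this]
  | cons y l ih =>
    have h1 := h (x * y :: l)
    have h2 := ih (g * x) y (fun m => φ (x :: m)) (fun m => F (g * x :: m))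
      (fun m => h (x :: m))
    have h3 : path g (x :: y :: l) = g * x :: path (g * x) (y :: l) := rfl
    rw [h3, hd_cons, h2]
    have h4 : path (g * x) (y :: l) = path g (x * y :: l) := by simp [path, mul_assoc]
    rw [h4, h1]
    simp [bp, add_comm]

/-- Homogenization. -/
def homog (ev : G → N →+ V) (φ : List G → N) : List G → V
  | [] => 0
  | g :: l => ev g (φ (diffs g l))

theorem homog_path (ev : G → N →+ V) (φ : List G → N) (g : G) (l : List G) :
    homog ev φ (g :: path g l) = ev g (φ l) := by
  simp [homog, diffs_path]

theorem hd_of_path (act : G → N → N) (ev : G → N →+ V)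
    (hev : ∀ g x n, ev g (act x n) = ev (g * x) n) (φ : List G → N) (E : List G → V)
    (hE0 : E [] = 0) (hE : ∀ g l, E (g :: path g l) = ev g (φ l)) (g : G) (l : List G) :
    hd E (g :: path g l) = ev g (dl act φ l) := by
  cases l with
  | nil => simp [path, hd, dl, hE0]
  | cons x l =>
    rw [hd_cons, hd_path (ev g) g x l φ (fun m => E (g :: m)) (hE g)]
    simp [dl, path, hev, hE]

theorem hd_homog (act : G → N → N) (ev : G → N →+ V)
    (hev : ∀ g x n, ev g (act x n) = ev (g * x) n) (φ : List G → N) (l : List G) :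
    hd (homog ev φ) l = homog ev (dl act φ) l := by
  cases l with
  | nil => rfl
  | cons g l =>
    have := hd_of_path act ev hev φ (homog ev φ) rfl (homog_path ev φ) g (diffs g l)
    rw [path_diffs] at this
    rw [this]; rfl

variable {k : Type} [CommRing k] [Module k V]

/-- Inhomogeneous cup product. -/
def icup (sc : k → N → N) (act : G → N → N) : ℕ → (List G → k) → (List G → N) → List G → N
  | 0, ξ, φ, l => sc (ξ []) (φ l)
  | _ + 1, _, _, [] => 0
  | a + 1, ξ, φ, x :: l => act x (icup sc act a (fun m => ξ (x :: m)) φ l)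

theorem hcup_path (sc : k → N → N) (act : G → N → N) (ev : G → N →+ V)
    (hev : ∀ g x n, ev g (act x n) = ev (g * x) n)
    (hsc : ∀ g c n, ev g (sc c n) = c • ev g n)
    (a : ℕ) (ξ Ξ : List G → k) (φ : List G → N) (E : List G → V) (g : G)
    (hΞ : ∀ l, Ξ (g :: path g l) = ξ l)
    (hE : ∀ g l, E (g :: path g l) = ev g (φ l)) (l : List G) :
    hcup a Ξ E (g :: path g l) = ev g (icup sc act a ξ φ l) := by
  induction a generalizing ξ Ξ g l with
  | zero =>
    have := hΞ []
    simp only [path] at this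
    simp [hcup, icup, hsc, hE, this]
  | succ a ih =>
    cases l with
    | nil => simp [path, hcup, icup, hcup_nil]
    | cons x l =>
      simp only [path, hcup, icup, hev]
      exact ih _ _ _ (fun m => hΞ (x :: m)) l

theorem hcup_homog (sc : k → N → N) (act : G → N → N) (ev : G → N →+ V)
    (hev : ∀ g x n, ev g (act x n) = ev (g * x) n)
    (hsc : ∀ g c n, ev g (sc c n) = c • ev g n)
    (a : ℕ) (ξ : List G → k) (φ : List G → N) (l : List G) :
    hcup a (homog (fun _ => AddMonoidHom.id k) ξ) (homog ev φ) l =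
      homog ev (icup sc act a ξ φ) l := by
  cases l with
  | nil => simp [hcup_nil, homog]
  | cons g l =>
    have := hcup_path sc act ev hev hsc a ξ _ φ _ g (homog_path (fun _ => AddMonoidHom.id k) ξ g)
      (homog_path ev φ) (diffs g l)
    rw [path_diffs] at this
    rw [this]; rfl

/-- The trivial action. -/
def tact (G : Type) (k : Type) : G → k → k := fun _ c => c

theorem hd_homog_triv (ξ : List G → k) (l : List G) :
    hd (homog (fun _ => AddMonoidHom.id k) ξ) l =
      homog (fun _ => AddMonoidHom.id k) (dl (tact G k) ξ) l :=
  hd_homog (tact G k) _ (fun _ _ _ => rfl) ξ l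

/-- Restriction zero on `H` gives an `H`-invariant homogeneous primitive. -/
theorem exists_eta (H : Subgroup G) (ξ : List G → k) (hξ : ∀ l, dl (tact G k) ξ l = 0)
    (η₀ : List H → k) (hη₀ : ∀ l : List H, ξ (l.map (↑)) = dl (tact H k) η₀ l) :
    ∃ η : List G → k, (∀ (h : H) l, η (l.map ((h : G) * ·)) = η l) ∧
      ∀ l, hd η l = homog (fun _ => AddMonoidHom.id k) ξ l := by
  obtain ⟨s, hs⟩ : ∃ s : G → H, ∀ (h : H) g, s (h * g) = h * s g := by
    let r : G → G := fun g => (Quotient.mk (QuotientGroup.rightRel H) g).out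
    have hr : ∀ g, g * (r g)⁻¹ ∈ H := by
      intro g
      have := Quotient.exact (Quotient.out_eq (Quotient.mk (QuotientGroup.rightRel H) g))
      exact QuotientGroup.rightRel_apply.1 this
    have hr2 : ∀ (h : H) g, r (h * g) = r g := by
      intro h g
      have : Quotient.mk (QuotientGroup.rightRel H) ((h : G) * g) =
          Quotient.mk (QuotientGroup.rightRel H) g := by
        apply Quotient.sound
        apply QuotientGroup.rightRel_apply.2
        simp
      show Quotient.out _ = Quotient.out _
      rw [this]
    refine ⟨fun g => ⟨g * (r g)⁻¹, hr g⟩, fun h g => ?_⟩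
    ext
    simp [hr2, mul_assoc]
  set Ξ := homog (fun _ => AddMonoidHom.id k) ξ with hΞ
  have hΞinv : ∀ (h : G) l, Ξ (l.map (h * ·)) = Ξ l := by
    intro h l
    cases l with
    | nil => rfl
    | cons g l => simp [hΞ, homog, diffs_map]
  have hdΞ : hd Ξ = fun _ => 0 := by
    funext l
    rw [hΞ, hd_homog_triv]
    cases l with
    | nil => rfl
    | cons g l => simp [homog, hξ]
  let H₀ : List H → k := homog (fun _ => AddMonoidHom.id k) η₀
  have hH₀inv : ∀ (h : H) l, H₀ (l.map (h * ·)) = H₀ l := by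
    intro h l
    cases l with
    | nil => rfl
    | cons g l => simp [H₀, homog, diffs_map]
  have hdH₀ : ∀ l : List H, hd H₀ l = Ξ (l.map (↑)) := by
    intro l
    rw [hd_homog_triv]
    cases l with
    | nil => rfl
    | cons g l =>
      have := diffs_hom H.subtype g l
      simp only [Subgroup.coe_subtype] at this
      rw [List.map_cons, hΞ, homog, homog, this, hη₀]
  let s' : G → G := fun g => (s g : G)
  refine ⟨fun l => H₀ (l.map s) - pr s' Ξ l, fun h l => ?_, fun l => ?_⟩
  · show H₀ ((l.map _).map s) - pr s' Ξ (l.map _) = _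
    rw [pr_equiv s' _ (by intro x; simp [s', hs])]
    congr 1
    · rw [← hH₀inv h (l.map s)]
      simp [Function.comp_def, hs]
    · congr 1
      funext m
      exact hΞinv h m
  · have h1 := prism s' Ξ l
    rw [hd_sub, hd_map, hdH₀]
    rw [hdΞ, pr_zero, add_zero] at h1
    rw [h1]
    simp [s', Function.comp_def]

end Inhom

end LC
namespace LC

section Nat

variable {G : Type} [Group G] {N N' : Type} [AddCommGroup N] [AddCommGroup N']

theorem bp_natural (T : N →+ N') (φ : List G → N) (l : List G) :
    T (bp φ l) = bp (fun m => T (φ m)) l := by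
  induction l generalizing φ with
  | nil => simp [bp]
  | cons x l ih =>
    cases l with
    | nil => simp [bp]
    | cons y l => simp [bp, ih]

theorem dl_natural (act : G → N → N) (act' : G → N' → N') (T : N →+ N')
    (hT : ∀ g n, T (act g n) = act' g (T n)) (φ : List G → N) (l : List G) :
    T (dl act φ l) = dl act' (fun m => T (φ m)) l := by
  cases l with
  | nil => simp [dl]
  | cons x l => simp [dl, hT, bp_natural]

theorem icup_natural {k : Type} (sc : k → N → N) (sc' : k → N' → N')
    (act : G → N → N) (act' : G → N' → N') (T : N →+ N')
    (hT : ∀ g n, T (act g n) = act' g (T n)) (hT' : ∀ g n, T (sc g n) = sc' g (T n))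
    (e : ℕ) (ξ : List G → k) (φ : List G → N) (l : List G) :
    T (icup sc act e ξ φ l) = icup sc' act' e ξ (fun m => T (φ m)) l := by
  induction e generalizing ξ l with
  | zero => simp [icup, hT']
  | succ e ih =>
    cases l with
    | nil => simp [icup]
    | cons x l => simp [icup, hT, ih]

theorem bp_add (φ ψ : List G → N) (l : List G) :
    bp (fun m => φ m + ψ m) l = bp φ l + bp ψ l := by
  induction l generalizing φ ψ with
  | nil => simp [bp]
  | cons x l ih =>
    cases l with
    | nil => simp [bp, add_comm]
    | cons y l => simp only [bp, ih]; abel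

end Nat

section AMod

variable {k : Type} [CommRing k] {G : Type} [Group G]
variable {N : Type} [AddCommGroup N] [Module (MonoidAlgebra k G) N]
variable {N' : Type} [AddCommGroup N'] [Module (MonoidAlgebra k G) N']

variable (k) in
/-- The action of a group element on a module over the group algebra. -/
noncomputable def aact (g : G) (n : N) : N := (MonoidAlgebra.single g (1 : k)) • n

variable (G) in
/-- The action of a scalar on a module over the group algebra. -/
noncomputable def asc (c : k) (n : N) : N := (MonoidAlgebra.single (1 : G) c) • n

variable (k) in
noncomputable def dA (φ : List G → N) : List G → N := dl (aact k) φ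

noncomputable def cA (e : ℕ) (ξ : List G → k) (φ : List G → N) : List G → N :=
  icup (asc G) (aact k) e ξ φ

theorem dA_natural (T : N →ₗ[MonoidAlgebra k G] N') (φ : List G → N) (l : List G) :
    T (dA k φ l) = dA k (fun m => T (φ m)) l :=
  dl_natural (aact k) (aact k) T.toAddMonoidHom (fun g n => by simp [aact]) φ l

theorem cA_natural (T : N →ₗ[MonoidAlgebra k G] N') (e : ℕ) (ξ : List G → k)
    (φ : List G → N) (l : List G) :
    T (cA e ξ φ l) = cA e ξ (fun m => T (φ m)) l :=
  icup_natural (asc G) (asc G) (aact k) (aact k) T.toAddMonoidHom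
    (fun g n => by simp [aact]) (fun g n => by simp [asc]) e ξ φ l

theorem dA_add (φ ψ : List G → N) (l : List G) :
    dA k (fun m => φ m + ψ m) l = dA k φ l + dA k ψ l := by
  cases l with
  | nil => simp [dA, dl]
  | cons x l => simp only [dA, dl, bp_add, aact, smul_add]; abel

theorem dA_smul (c : ℤ) (φ : List G → N) (l : List G) :
    dA k (fun m => c • φ m) l = c • dA k φ l :=
  (dA_natural (k := k) (c • (LinearMap.id : N →ₗ[MonoidAlgebra k G] N)) φ l).symm

theorem dA_zero (l : List G) : dA k (fun _ => (0 : N)) l = 0 := by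
  have := dA_smul (k := k) 0 (fun _ : List G => (0 : N)) l
  simpa using this

theorem cA_add (e : ℕ) (ξ : List G → k) (φ ψ : List G → N) (l : List G) :
    cA e ξ (fun m => φ m + ψ m) l = cA e ξ φ l + cA e ξ ψ l := by
  unfold cA
  induction e generalizing ξ l with
  | zero => simp [icup, asc]
  | succ e ih =>
    cases l with
    | nil => simp [icup]
    | cons x l => simp [icup, ih, aact]

theorem cA_smul (c : ℤ) (e : ℕ) (ξ : List G → k) (φ : List G → N) (l : List G) :
    cA e ξ (fun m => c • φ m) l = c • cA e ξ φ l :=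
  (cA_natural (c • (LinearMap.id : N →ₗ[MonoidAlgebra k G] N)) e ξ φ l).symm

variable (k) in
/-- Evaluation maps for homogenizing. -/
noncomputable def evA (g : G) : N →+ N :=
  DistribSMul.toAddMonoidHom N (MonoidAlgebra.single g (1 : k))

theorem evA_act (g x : G) (n : N) : evA k g (aact k x n) = evA k (g * x) n := by
  simp [evA, aact, smul_smul, MonoidAlgebra.single_mul_single]

theorem evA_one (n : N) : evA k (1 : G) n = n := by
  simp [evA, ← MonoidAlgebra.one_def]

theorem homog_one (φ : List G → N) (l : List G) :
    homog (evA k) φ (1 :: path 1 l) = φ l := by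
  rw [homog_path, evA_one]

theorem dA_dA (φ : List G → N) (l : List G) : dA k (dA k φ) l = 0 := by
  rw [← homog_one (k := k) (dA k (dA k φ)), dA, ← hd_homog (aact k) (evA k) evA_act]
  have : homog (evA k) (dA k φ) = hd (homog (evA k) φ) := by
    funext m
    rw [hd_homog (aact k) (evA k) evA_act]; rfl
  rw [this, hd_hd]

theorem dA_cA (e : ℕ) (ξ : List G → k) (hξ : ∀ l, dl (tact G k) ξ l = 0)
    (φ : List G → N) (l : List G) :
    dA k (cA e ξ φ) l = (-1 : ℤ) ^ e • cA e ξ (dA k φ) l := by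
  let _ : Module k N := Module.compHom N (algebraMap k (MonoidAlgebra k G))
  have hsc : ∀ (g : G) (c : k) (n : N), evA k g (asc G c n) = c • evA k g n := by
    intro g c n
    change (MonoidAlgebra.single g (1 : k)) • (MonoidAlgebra.single (1 : G) c) • n =
      algebraMap k (MonoidAlgebra k G) c • (MonoidAlgebra.single g (1 : k)) • n
    simp [smul_smul, MonoidAlgebra.single_mul_single]
  rw [← homog_one (k := k) (dA k (cA e ξ φ)), dA, ← hd_homog (aact k) (evA k) evA_act]
  have h1 : homog (evA k) (cA e ξ φ) =
      hcup e (homog (fun _ => AddMonoidHom.id k) ξ) (homog (evA k) φ) := by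
    funext m
    rw [hcup_homog (asc G) (aact k) (evA k) evA_act hsc]; rfl
  have h2 : hd (homog (fun _ => AddMonoidHom.id k) ξ) = fun _ => 0 := by
    funext m
    rw [hd_homog_triv]
    cases m with
    | nil => rfl
    | cons g m => simp [homog, hξ]
  have h3 : hd (homog (evA k) φ) = homog (evA k) (dA k φ) := by
    funext m
    exact hd_homog (aact k) (evA k) evA_act φ m
  rw [h1, leibniz _ _ _ rfl, h2, hcup_zero_left, zero_add, h3,
    hcup_homog (asc G) (aact k) (evA k) evA_act hsc, homog_one]
  rfl

/-- Multiplication by `ξ` is zero on cohomology. -/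
def Killed (e : ℕ) (ξ : List G → k) (N : Type) [AddCommGroup N]
    [Module (MonoidAlgebra k G) N] : Prop :=
  ∀ φ : List G → N, (∀ l, dA k φ l = 0) → ∃ ψ : List G → N, ∀ l, cA e ξ φ l = dA k ψ l

theorem Killed.of_equiv {e : ℕ} {ξ : List G → k} (f : N ≃ₗ[MonoidAlgebra k G] N')
    (h : Killed e ξ N') : Killed e ξ N := by
  intro φ hφ
  obtain ⟨ψ, hψ⟩ := h (fun l => f (φ l)) (fun l => by
    have := dA_natural f.toLinearMap φ l
    rw [hφ, map_zero] at this
    exact this.symm)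
  refine ⟨fun l => f.symm (ψ l), fun l => ?_⟩
  have h1 := dA_natural f.symm.toLinearMap ψ l
  have h2 := cA_natural f.toLinearMap e ξ φ l
  simp only [LinearEquiv.coe_coe] at h1 h2
  rw [← h1, ← hψ, ← h2, LinearEquiv.symm_apply_apply]

theorem Killed.pi {e : ℕ} {ξ : List G → k} {ι : Type} (Q : ι → Type)
    [∀ i, AddCommGroup (Q i)] [∀ i, Module (MonoidAlgebra k G) (Q i)]
    (h : ∀ i, Killed e ξ (Q i)) : Killed e ξ (∀ i, Q i) := by
  intro φ hφ
  have := fun i => h i (fun l => φ l i) (fun l => by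
    have := dA_natural (LinearMap.proj i : (∀ i, Q i) →ₗ[MonoidAlgebra k G] Q i) φ l
    rw [hφ, map_zero] at this
    exact this.symm)
  choose ψ hψ using this
  refine ⟨fun l i => ψ i l, fun l => funext fun i => ?_⟩
  have h1 := dA_natural (LinearMap.proj i : (∀ i, Q i) →ₗ[MonoidAlgebra k G] Q i)
    (fun l i => ψ i l) l
  have h2 := cA_natural (LinearMap.proj i : (∀ i, Q i) →ₗ[MonoidAlgebra k G] Q i) e ξ φ l
  simp only [LinearMap.proj_apply] at h1 h2
  rw [h1, h2, hψ]

theorem Killed.coind {e : ℕ} {ξ : List G → k} (hξ : ∀ l, dl (tact G k) ξ l = 0)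
    (H : Subgroup G) (η₀ : List H → k)
    (hη₀ : ∀ l : List H, ξ (l.map (↑)) = dl (tact H k) η₀ l)
    {V : Type} [AddCommGroup V] [Module k V] (τ : Representation k H V) :
    Killed e ξ (coindRep k H τ).asModule := by
  intro φ hφ
  cases e with
  | zero =>
    have h0 : ξ [] = 0 := by simpa [dl] using hη₀ []
    refine ⟨fun _ => 0, fun l => ?_⟩
    rw [dA_zero]
    simp [cA, icup, asc, h0]
  | succ a =>
    obtain ⟨η, hηinv, hη⟩ := exists_eta H ξ hξ η₀ hη₀
    let ev : G → (coindRep k H τ).asModule →+ V := fun g =>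
      { toFun := fun n => ((coindRep k H τ).asModuleEquiv n).1 g
        map_zero' := by simp
        map_add' := by intro x y; simp }
    have hev : ∀ (g x : G) n, ev g (aact k x n) = ev (g * x) n := by
      intro g x n
      simp only [ev, aact, AddMonoidHom.coe_mk, ZeroHom.coe_mk,
        Representation.asModuleEquiv_map_smul, Representation.asAlgebraHom_single, one_smul]
      rfl
    have hsc : ∀ (g : G) (c : k) n, ev g (asc G c n) = c • ev g n := by
      intro g c n
      simp only [ev, asc, AddMonoidHom.coe_mk, ZeroHom.coe_mk,
        Representation.asModuleEquiv_map_smul, Representation.asAlgebraHom_single, map_one]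
      rfl
    have hinj : ∀ n n', (∀ g, ev g n = ev g n') → n = n' := by
      intro n n' h
      apply (coindRep k H τ).asModuleEquiv.injective
      exact Subtype.ext (funext h)
    have hevH : ∀ (h : H) (g : G) n, ev (h * g) n = τ h (ev g n) := by
      intro h g n
      exact ((coindRep k H τ).asModuleEquiv n).2 h g
    let F := homog ev φ
    have hF : ∀ (h : H) l, F (l.map ((h : G) * ·)) = τ h (F l) := by
      intro h l
      cases l with
      | nil => simp [F, homog]
      | cons g l => simp [F, homog, diffs_map, hevH]
    let E := hcup a η F
    have hE : ∀ (h : H) l, E (l.map ((h : G) * ·)) = τ h (E l) := by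
      intro h l
      exact hcup_equiv _ (τ h) a η F (hηinv h) (hF h) l
    have hdF : hd F = fun _ => 0 := by
      funext l
      show hd (homog ev φ) l = 0
      rw [hd_homog (aact k) ev hev]
      cases l with
      | nil => rfl
      | cons g l =>
        have := hφ (diffs g l)
        rw [dA] at this
        simp [homog, this]
    have hdE : ∀ l, hd E l = homog ev (cA (a + 1) ξ φ) l := by
      intro l
      have hη' : hd η = homog (fun _ => AddMonoidHom.id k) ξ := funext hη
      show hd (hcup a η F) l = _
      rw [leibniz _ _ _ rfl, hdF, hcup_zero_right, smul_zero, add_zero, hη',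
        hcup_homog (asc G) (aact k) ev hev hsc]
      rfl
    let ψ : List G → (coindRep k H τ).asModule := fun l =>
      (coindRep k H τ).asModuleEquiv.symm ⟨fun g => E (g :: path g l), fun h g => by
        show E (_ :: path _ l) = _
        rw [path_map, ← hE]
        rfl⟩
    refine ⟨ψ, fun l => hinj _ _ fun g => ?_⟩
    have h1 := hd_of_path (aact k) ev hev ψ E (hcup_nil _ _ _) (fun g l => by
      simp [ev, ψ]) g l
    rw [dA, ← h1, hdE, homog_path]

/-- One step of the filtration argument. -/
theorem step {e : ℕ} {ξ : List G → k} (hξ : ∀ l, dl (tact G k) ξ l = 0)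
    (S T : Submodule (MonoidAlgebra k G) N)
    (hQ : Killed e ξ (T ⧸ Submodule.comap T.subtype S))
    (φ : List G → N) (hφT : ∀ l, φ l ∈ T) (hφ : ∀ l, dA k φ l = 0) :
    ∃ ψ φ' : List G → N, (∀ l, φ' l ∈ S) ∧ (∀ l, dA k φ' l = 0) ∧
      ∀ l, cA e ξ φ l = dA k ψ l + φ' l := by
  let φ₁ : List G → T := fun l => ⟨φ l, hφT l⟩
  have hφ₁ : ∀ l, dA k φ₁ l = 0 := by
    intro l
    apply Subtype.ext
    exact (dA_natural T.subtype φ₁ l).trans (hφ l)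
  let q := (Submodule.comap T.subtype S).mkQ
  obtain ⟨ψb, hψb⟩ := hQ (fun l => q (φ₁ l)) (fun l => by
    rw [← dA_natural q, hφ₁, map_zero])
  choose ψ₁ hψ₁ using fun l => Submodule.mkQ_surjective (Submodule.comap T.subtype S) (ψb l)
  have hψ₁' : (fun l => q (ψ₁ l)) = ψb := funext hψ₁
  let ψ : List G → N := fun l => (ψ₁ l : N)
  have hcc : ∀ l, cA e ξ φ l = ((cA e ξ φ₁ l : T) : N) := fun l =>
    (cA_natural T.subtype e ξ φ₁ l).symm
  have hdd : ∀ l, dA k ψ l = ((dA k ψ₁ l : T) : N) := fun l =>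
    (dA_natural T.subtype ψ₁ l).symm
  refine ⟨ψ, fun l => cA e ξ φ l + (-1 : ℤ) • dA k ψ l, fun l => ?_, fun l => ?_, fun l => ?_⟩
  · have : q (cA e ξ φ₁ l - dA k ψ₁ l) = 0 := by
      rw [map_sub, cA_natural q, dA_natural q, hψb, hψ₁', sub_self]
    have := (Submodule.Quotient.mk_eq_zero _).1 this
    rw [Submodule.mem_comap] at this
    show cA e ξ φ l + (-1 : ℤ) • dA k ψ l ∈ S
    rw [hcc, hdd]
    simpa [sub_eq_add_neg] using this
  · rw [dA_add, dA_smul, dA_dA, dA_cA e ξ hξ]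
    have h0 : dA k φ = fun _ => 0 := funext hφ
    have := cA_smul 0 e ξ φ l
    simp only [zero_smul] at this
    rw [h0, this]
    simp
  · simp

theorem iter_add (e : ℕ) (ξ : List G → k) (i : ℕ) (φ ψ : List G → N) (l : List G) :
    (cA e ξ)^[i] (fun m => φ m + ψ m) l = (cA e ξ)^[i] φ l + (cA e ξ)^[i] ψ l := by
  induction i generalizing l with
  | zero => rfl
  | succ i ih =>
    simp only [Function.iterate_succ_apply']
    rw [← cA_add]
    congr 1
    funext m
    exact ih m

theorem iter_d (e : ℕ) (ξ : List G → k) (hξ : ∀ l, dl (tact G k) ξ l = 0)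
    (i : ℕ) (ψ : List G → N) :
    ∃ ψ' : List G → N, (cA e ξ)^[i] (dA k ψ) = dA k ψ' := by
  induction i with
  | zero => exact ⟨ψ, rfl⟩
  | succ i ih =>
    obtain ⟨ψ', h⟩ := ih
    refine ⟨fun m => (-1 : ℤ) ^ e • cA e ξ ψ' m, ?_⟩
    rw [Function.iterate_succ_apply', h]
    funext l
    rw [dA_smul, dA_cA e ξ hξ, smul_smul, ← mul_pow]
    simp

theorem filt {e : ℕ} {ξ : List G → k} (hξ : ∀ l, dl (tact G k) ξ l = 0) (r : ℕ)
    (F : Fin (r + 1) → Submodule (MonoidAlgebra k G) N) (hF0 : F 0 = ⊥)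
    (hQ : ∀ i : Fin r, Killed e ξ
      (F i.succ ⧸ Submodule.comap (F i.succ).subtype (F i.castSucc)))
    (i : Fin (r + 1)) (φ : List G → N) (hφF : ∀ l, φ l ∈ F i) (hφ : ∀ l, dA k φ l = 0) :
    ∃ ψ : List G → N, (cA e ξ)^[(i : ℕ)] φ = dA k ψ := by
  induction i using Fin.induction generalizing φ with
  | zero =>
    refine ⟨fun _ => 0, funext fun l => ?_⟩
    rw [dA_zero]
    have := hφF l
    rw [hF0] at this
    simpa using this
  | succ i ih =>
    obtain ⟨ψ, φ', h1, h2, h3⟩ := step hξ _ _ (hQ i) φ hφF hφ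
    obtain ⟨ψ', h4⟩ := ih φ' h1 h2
    obtain ⟨ψ'', h5⟩ := iter_d e ξ hξ (i : ℕ) ψ
    refine ⟨fun l => ψ'' l + ψ' l, funext fun l => ?_⟩
    rw [Fin.val_succ, Function.iterate_succ_apply, funext h3, iter_add, dA_add, h5]
    congr 1
    exact congrFun h4 l

end AMod

section Transfer

variable {K : Type} [Group K] {V : Type} [AddCommGroup V]

/-- Extension by zero of a cochain to all lists. -/
def ext0 (n : ℕ) (φ : (Fin n → K) → V) : List K → V := fun l =>
  if h : l.length = n then φ (fun i => l.get (i.cast h.symm)) else 0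

theorem ext0_ofFn (n : ℕ) (φ : (Fin n → K) → V) (g : Fin n → K) :
    ext0 n φ (List.ofFn g) = φ g := by
  simp [ext0]

theorem ext0_off (n : ℕ) (φ : (Fin n → K) → V) (l : List K) (h : l.length ≠ n) :
    ext0 n φ l = 0 := by
  simp [ext0, h]

theorem exists_ofFn (n : ℕ) (l : List K) (h : l.length = n) : ∃ g : Fin n → K, l = List.ofFn g := by
  subst h
  exact ⟨l.get, (List.ofFn_get l).symm⟩

theorem bp_off (n : ℕ) (φ : List K → V) (hφ : ∀ l, l.length ≠ n → φ l = 0) (l : List K)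
    (hl : l.length ≠ n + 1) : bp φ l = 0 := by
  induction l generalizing φ n with
  | nil => rfl
  | cons x l ih =>
    cases l with
    | nil =>
      rw [bp, hφ, neg_zero]
      simp at hl ⊢; omega
    | cons y l =>
      rw [bp, hφ (x * y :: l) (by simp at hl ⊢; omega)]
      cases n with
      | zero =>
        rw [ih (l.length + 1) _ (fun m _ => hφ _ (by simp)) (by simp)]
        simp
      | succ n =>
        rw [ih n _ (fun m hm => hφ _ (by simpa using hm)) (by simp at hl ⊢; omega)]
        simp

theorem dl_off (act : K → V → V) (hact : ∀ g, act g 0 = 0)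
    (n : ℕ) (φ : List K → V) (hφ : ∀ l, l.length ≠ n → φ l = 0) (l : List K)
    (hl : l.length ≠ n + 1) : dl act φ l = 0 := by
  cases l with
  | nil => rfl
  | cons x l =>
    rw [dl, hφ l (by simpa using hl), hact, bp_off n φ hφ _ hl, add_zero]

theorem bp_ofFn (n : ℕ) (φ : List K → V) (g : Fin (n + 1) → K) :
    bp φ (List.ofFn g) = ∑ j : Fin (n + 1), ((-1 : ℤ) ^ ((j : ℕ) + 1)) •
      φ (List.ofFn (Fin.contractNth j (· * ·) g)) := by
  induction n generalizing φ with
  | zero => simp [bp]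
  | succ n ih =>
    rw [Fin.sum_univ_succ]
    have h0 : List.ofFn (Fin.contractNth 0 (· * ·) g) =
        g 0 * g 1 :: List.ofFn (fun i : Fin n => g i.succ.succ) := by
      rw [List.ofFn_succ]
      congr 1
    have hs : ∀ j : Fin (n + 1), List.ofFn (Fin.contractNth j.succ (· * ·) g) =
        g 0 :: List.ofFn (Fin.contractNth j (· * ·) (fun i => g i.succ)) := by
      intro j
      rw [List.ofFn_succ]
      congr 1
      congr 1
      funext i
      simp [Fin.contractNth]
    have hg : List.ofFn g = g 0 :: g 1 :: List.ofFn (fun i : Fin n => g i.succ.succ) := by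
      rw [List.ofFn_succ, List.ofFn_succ]
      rfl
    have hg' : g 1 :: List.ofFn (fun i : Fin n => g i.succ.succ) =
        List.ofFn (fun i => g i.succ) := by
      rw [List.ofFn_succ]; rfl
    rw [hg, bp, hg', ih, h0]
    simp only [hs]
    simp [pow_succ, sub_eq_add_neg]

variable {k : Type} [CommRing k] [Module k V]

theorem dRep_eq (ρ : Representation k K V) (n : ℕ) (φ : (Fin n → K) → V) (φ' : List K → V)
    (h : ∀ g, φ' (List.ofFn g) = φ g) (g : Fin (n + 1) → K) :
    dRep ρ n φ g = dl (fun x v => ρ x v) φ' (List.ofFn g) := by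
  rw [List.ofFn_succ, dl, ← List.ofFn_succ, bp_ofFn]
  simp only [h]
  rfl

theorem dl_ext0 (ρ : Representation k K V) (n : ℕ) (φ : (Fin n → K) → V) :
    dl (fun x v => ρ x v) (ext0 n φ) = ext0 (n + 1) (dRep ρ n φ) := by
  funext l
  by_cases hl : l.length = n + 1
  · obtain ⟨g, rfl⟩ := exists_ofFn _ l hl
    rw [ext0_ofFn, dRep_eq ρ n φ _ (ext0_ofFn n φ)]
  · rw [ext0_off _ _ _ hl, dl_off _ (by simp) n _ (ext0_off n φ) _ hl]

theorem isCobound_of (ρ : Representation k K V) (n : ℕ) (φ : (Fin n → K) → V) (ψ : List K → V)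
    (h : ∀ g, φ g = dl (fun x v => ρ x v) ψ (List.ofFn g)) : IsCoboundRep ρ n φ := by
  cases n with
  | zero =>
    show φ = 0
    funext g
    rw [h]
    simp [dl]
  | succ n =>
    refine ⟨fun g => ψ (List.ofFn g), funext fun g => ?_⟩
    rw [h, dRep_eq ρ n _ ψ (fun _ => rfl)]

theorem of_isCobound (ρ : Representation k K V) (n : ℕ) (φ : (Fin n → K) → V)
    (h : IsCoboundRep ρ n φ) :
    ∃ ψ : List K → V, ∀ l, ext0 n φ l = dl (fun x v => ρ x v) ψ l := by
  cases n with
  | zero =>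
    have h' : φ = 0 := h
    have hz : (fun _ => 0 : List K → V) = ext0 0 0 := by
      funext l; simp [ext0]
    refine ⟨fun _ => 0, fun l => ?_⟩
    rw [hz, dl_ext0, h']
    have : dRep ρ 0 0 = 0 := by
      funext g; simp [dRep]
    rw [this]
    simp [ext0]
  | succ n =>
    obtain ⟨ψ, rfl⟩ := h
    exact ⟨ext0 n ψ, fun l => by rw [dl_ext0]⟩

theorem cA_append (ρ : Representation k K V) (e : ℕ) (ξ : List K → k)
    (φ : List K → ρ.asModule) (l₁ l₂ : List K) (h : l₁.length = e) :
    cA e ξ φ (l₁ ++ l₂) = ρ.asModuleEquiv.symm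
      (ξ l₁ • ρ l₁.prod (ρ.asModuleEquiv (φ l₂))) := by
  unfold cA
  induction l₁ generalizing e ξ with
  | nil =>
    subst h
    apply ρ.asModuleEquiv.injective
    rw [LinearEquiv.apply_symm_apply]
    show ρ.asModuleEquiv (MonoidAlgebra.single (1 : K) (ξ []) • φ l₂) = _
    rw [Representation.asModuleEquiv_map_smul, Representation.asAlgebraHom_single]
    simp
  | cons x l₁ ih =>
    subst h
    apply ρ.asModuleEquiv.injective
    rw [LinearEquiv.apply_symm_apply]
    show ρ.asModuleEquiv (MonoidAlgebra.single x (1 : k) •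
      icup (asc K) (aact k) l₁.length (fun m => ξ (x :: m)) φ (l₁ ++ l₂)) = _
    rw [Representation.asModuleEquiv_map_smul, Representation.asAlgebraHom_single,
      ih _ _ rfl, LinearEquiv.apply_symm_apply, List.prod_cons, map_mul, one_smul, map_smul]
    rfl

theorem iter_eq (ρ : Representation k K V) (e : ℕ) (ξ : (Fin e → K) → k) (n : ℕ)
    (φ : (Fin n → K) → V) (φ' : List K → ρ.asModule)
    (h : ∀ g, ρ.asModuleEquiv (φ' (List.ofFn g)) = φ g) (D : ℕ) (g : Fin (D * e + n) → K) :
    cupRep ρ (D * e) n (cupPow e ξ D) φ g =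
      ρ.asModuleEquiv ((cA e (ext0 e ξ))^[D] φ' (List.ofFn g)) := by
  have key : ∀ (D : ℕ) (u : Fin (D * e) → K) (w : Fin n → K),
      ρ.asModuleEquiv ((cA e (ext0 e ξ))^[D] φ' (List.ofFn u ++ List.ofFn w)) =
        cupPow e ξ D u • ρ (List.ofFn u).prod (φ w) := by
    intro D
    induction D with
    | zero =>
      intro u w
      have : List.ofFn u = [] := by
        apply List.eq_nil_of_length_eq_zero; simp
      simp [this, cupPow, h]
    | succ D ih =>
      intro u w
      let u₁ : Fin e → K := fun i => u (Fin.cast (by ring) (Fin.castAdd (D * e) i))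
      let u₂ : Fin (D * e) → K := fun i => u (Fin.cast (by ring) (Fin.natAdd e i))
      have hu : List.ofFn u = List.ofFn u₁ ++ List.ofFn u₂ := by
        rw [List.ofFn_congr (show (D + 1) * e = e + D * e by ring), List.ofFn_add]
        rfl
      rw [Function.iterate_succ_apply', hu, List.append_assoc,
        cA_append ρ _ _ _ _ _ (by simp), LinearEquiv.apply_symm_apply, ih, ext0_ofFn]
      simp [cupPow, u₁, u₂, smul_smul]
  have hg : List.ofFn g = List.ofFn (fun i => g (Fin.castAdd n i)) ++
      List.ofFn (fun i => g (Fin.natAdd (D * e) i)) := List.ofFn_add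
  rw [hg, key]
  rfl

end Transfer

end LC

/-- The general form, for an arbitrary group. -/
theorem LC.main (p : ℕ) {G : Type} [Group G]
    {M : Type} [AddCommGroup M] [Module (ZMod p) M]
    (ρ : Representation (ZMod p) G M)
    (hM : InFJ p G ρ.asModule)
    (e : ℕ) (ξ : (Fin e → G) → ZMod p)
    (hcocycle : dRep (Representation.trivial (ZMod p) (G := G) (V := ZMod p)) e ξ = 0)
    (hres : ∀ H : Subgroup G, H ≠ ⊤ →
      IsCoboundRep (Representation.trivial (ZMod p) (G := H) (V := ZMod p)) e
        (fun g : Fin e → H => ξ fun i => (g i : G))) :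
    ∃ D : ℕ, ∀ (n : ℕ) (φ : (Fin n → G) → M),
      dRep ρ n φ = 0 →
        IsCoboundRep ρ (D * e + n) (cupRep ρ (D * e) n (cupPow e ξ D) φ) := by
  classical
  obtain ⟨r, F, -, hF0, hFr, hJ⟩ := hM
  let ξ' : List G → ZMod p := LC.ext0 e ξ
  have hξ' : ∀ l, LC.dl (LC.tact G (ZMod p)) ξ' l = 0 := by
    intro l
    have h := congrFun (LC.dl_ext0
      (Representation.trivial (ZMod p) (G := G) (V := ZMod p)) e ξ) l
    rw [hcocycle] at h
    refine Eq.trans h ?_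
    simp [LC.ext0]
  have hK : ∀ P : ProperInducedRep p G, LC.Killed e ξ' P.asMod := by
    intro P
    obtain ⟨η₀, hη₀⟩ := LC.of_isCobound _ _ _ (hres P.H P.proper)
    refine LC.Killed.coind hξ' P.H η₀ (fun l => ?_) P.rep
    refine Eq.trans ?_ (hη₀ l)
    simp only [ξ', LC.ext0, List.length_map]
    split_ifs
    · simp
    · rfl
  have hQ : ∀ i : Fin r, LC.Killed e ξ'
      (F i.succ ⧸ Submodule.comap (F i.succ).subtype (F i.castSucc)) := by
    intro i
    obtain ⟨t, P, ⟨f⟩⟩ := hJ i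
    exact LC.Killed.of_equiv
      (f.trans (DirectSum.linearEquivFunOnFintype (MonoidAlgebra (ZMod p) G) (Fin t)
        (fun i => (P i).asMod)))
      (LC.Killed.pi _ fun i => hK (P i))
  have hact : ∀ (φ : List G → M) (l : List G),
      LC.dA (ZMod p) (fun m => ρ.asModuleEquiv.symm (φ m)) l =
        ρ.asModuleEquiv.symm (LC.dl (fun x v => ρ x v) φ l) := by
    intro φ l
    refine (LC.dl_natural _ _ (ρ.asModuleEquiv.symm.toLinearMap.toAddMonoidHom) ?_ φ l).symm
    intro g n
    exact ρ.asModuleEquiv_symm_map_rho g n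
  refine ⟨r, fun n φ hφ => ?_⟩
  let φ' : List G → ρ.asModule := fun m => ρ.asModuleEquiv.symm (LC.ext0 n φ m)
  obtain ⟨ψ, hψ⟩ := LC.filt hξ' r F hF0 hQ (Fin.last r) φ' (by simp [hFr]) (by
    intro l
    rw [hact, LC.dl_ext0, hφ]
    simp [LC.ext0])
  refine LC.isCobound_of ρ _ _ (fun m => ρ.asModuleEquiv (ψ m)) fun g => ?_
  rw [LC.iter_eq ρ e ξ n φ φ' (by intro g; simp [φ', LC.ext0_ofFn])]
  rw [Fin.val_last] at hψ
  rw [hψ]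
  apply ρ.asModuleEquiv.symm.injective
  rw [← hact]
  simp

/-- Let `G = (ℤ/p)^κ` be an elementary abelian `p`-group and let `M` be an
`F_p[G]`-module (a representation `ρ` of `G` over `F_p`) whose associated `F_p[G]`-module
lies in `𝔉𝔍_G`.  If a class `ξ ∈ H^*(G; F_p)` (a cocycle) restricts to zero in
`H^*(H; F_p)` for every proper subgroup `H < G` (its restriction is a coboundary), then
multiplication by `ξ` on the group cohomology `H^*(G; M)` is nilpotent: there is a `D` such
that `ξ^{∪D} ∪ φ` is a coboundary for every cocycle `φ` with coefficients in `ρ`. -/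
theorem stmt_5 (p : ℕ) (hp : p.Prime) (κ : ℕ)
    {M : Type} [AddCommGroup M] [Module (ZMod p) M]
    (ρ : Representation (ZMod p) (Fin κ → Multiplicative (ZMod p)) M)
    (hM : InFJ p (Fin κ → Multiplicative (ZMod p)) ρ.asModule)
    (e : ℕ) (ξ : (Fin e → (Fin κ → Multiplicative (ZMod p))) → ZMod p)
    (hcocycle : dRep (Representation.trivial (ZMod p)
      (G := Fin κ → Multiplicative (ZMod p)) (V := ZMod p)) e ξ = 0)
    (hres : ∀ H : Subgroup (Fin κ → Multiplicative (ZMod p)), H ≠ ⊤ →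
      IsCoboundRep (Representation.trivial (ZMod p) (G := H) (V := ZMod p)) e
        (fun g : Fin e → H => ξ fun i => (g i : Fin κ → Multiplicative (ZMod p)))) :
    ∃ D : ℕ, ∀ (n : ℕ) (φ : (Fin n → (Fin κ → Multiplicative (ZMod p))) → M),
      dRep ρ n φ = 0 →
        IsCoboundRep ρ (D * e + n) (cupRep ρ (D * e) n (cupPow e ξ D) φ) := by
  exact LC.main p ρ hM e ξ hcocycle hres
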